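/- arXiv:2411.04306 — 7 statements merged into one kernel-verified Lean document; each statement's English description precedes it below -/
import Mathlib

section
/- Let F be a field, d a positive integer, and C_X, C_Z linear subspaces of F^d satisfying C_Z^⊥ ⊆ C_X and C_X^⊥ ⊆ C_Z, where ⊥ denotes orthogonal complement with respect to the standard bilinear form ⟨u,v⟩ = Σ_i u_i v_i on F^d. Let W_X and W_Z be subspaces with C_X = W_X ⊕ C_Z^⊥ and C_Z = W_Z ⊕ C_X^⊥. Then the standard bilinear form restricted to W_X × W_Z is nondegenerate (i.e., for every nonzero x ∈ W_X there is y ∈ W_Z with ⟨x,y⟩ ≠ 0, and for every nonzero y ∈ W_Z there is x ∈ W_X with ⟨x,y⟩ ≠ 0); consequently dim W_X = dim W_Z =: k, and there exist F-linear isomorphisms φ_X : F^k → W_X and φ_Z : F^k → W_Z such that ⟨φ_X(x), φ_Z(y)⟩ = ⟨x,y⟩ for all x,y ∈ F^k. -/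
open scoped BigOperators

/-- A module equipped with a choice of "standard" bilinear dot product. -/
class DotSpace (F : Type*) [Field F] (M : Type*) [AddCommGroup M] [Module F M] where
  dot : M →ₗ[F] M →ₗ[F] F

/-- On the field itself the standard bilinear form is multiplication. -/
noncomputable instance (F : Type*) [Field F] : DotSpace F F :=
  ⟨LinearMap.mul F F⟩

/-- On a (finite) product, the standard bilinear form is the coordinatewise sum
`⟨u,v⟩ = ∑ i ⟨u i, v i⟩`. -/
noncomputable instance (F : Type*) [Field F] (ι : Type*) [Fintype ι]
    (M : Type*) [AddCommGroup M] [Module F M] [DotSpace F M] : DotSpace F (ι → M) where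
  dot := LinearMap.mk₂ F (fun u v => ∑ i, DotSpace.dot (F := F) (u i) (v i))
    (fun a b c => by simp [Finset.sum_add_distrib])
    (fun t a b => by simp [Finset.mul_sum])
    (fun a b c => by simp [Finset.sum_add_distrib])
    (fun t a b => by simp [Finset.mul_sum])

/-- The standard dot product `⟨u,v⟩ = ∑ i u_i v_i`. -/
def dotp (F : Type*) [Field F] {M : Type*} [AddCommGroup M] [Module F M] [DotSpace F M]
    (u v : M) : F := DotSpace.dot (F := F) u v

/-- Orthogonal complement `V^⊥ = {w | ∀ v ∈ V, ⟨v,w⟩ = 0}` with respect to the standard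
bilinear form. -/
def orth {F : Type*} [Field F] {M : Type*} [AddCommGroup M] [Module F M] [DotSpace F M]
    (V : Submodule F M) : Submodule F M where
  carrier := {w | ∀ v ∈ V, dotp F v w = 0}
  zero_mem' := fun v _ => map_zero (DotSpace.dot (F := F) v)
  add_mem' := fun {a b} ha hb v hv => by
    have h1 := ha v hv; have h2 := hb v hv
    unfold dotp at *
    rw [map_add, h1, h2, add_zero]
  smul_mem' := fun c a ha v hv => by
    have h1 := ha v hv
    unfold dotp at *
    rw [map_smul, h1, smul_zero]

/-- The standard form on `ι → F` is the dot product. -/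
theorem dotp_eq_dotProduct {F : Type*} [Field F] {ι : Type*} [Fintype ι] (u v : ι → F) :
    dotp F u v = u ⬝ᵥ v := rfl

theorem dotp_comm {F : Type*} [Field F] {ι : Type*} [Fintype ι] (u v : ι → F) :
    dotp F u v = dotp F v u := by
  simp only [dotp_eq_dotProduct, dotProduct_comm]

/-- If `W ⊆ C`, `W` meets `D^⊥` trivially and `D = V + C^⊥`, then no nonzero vector of `W` is
orthogonal to all of `V`. -/
theorem exists_dotp_ne_zero {F : Type*} [Field F] {ι : Type*} [Fintype ι]
    {C D W V : Submodule F (ι → F)} (hW : W ≤ C) (hinf : W ⊓ orth D = ⊥)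
    (hsup : V ⊔ orth C = D) (x : ι → F) (hx : x ∈ W) (hx0 : x ≠ 0) :
    ∃ y ∈ V, dotp F x y ≠ 0 := by
  by_contra! h
  refine hx0 ((Submodule.mem_bot F).1 (hinf ▸ Submodule.mem_inf.2 ⟨hx, fun v hv => ?_⟩))
  rw [← hsup] at hv
  obtain ⟨y, hy, z, hz, rfl⟩ := Submodule.mem_sup.1 hv
  rw [dotp_comm, dotp_eq_dotProduct, dotProduct_add, ← dotp_eq_dotProduct,
    ← dotp_eq_dotProduct, h y hy, hz x (hW hx), add_zero]

/-- A perfect pairing of finite-dimensional spaces is isomorphic to the dot product. -/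
theorem LinearMap.IsPerfPair.exists_equiv_dotProduct {F M N : Type*} [Field F]
    [AddCommGroup M] [Module F M] [AddCommGroup N] [Module F N] [FiniteDimensional F M]
    (p : M →ₗ[F] N →ₗ[F] F) [p.IsPerfPair] :
    ∃ (eM : (Fin (Module.finrank F M) → F) ≃ₗ[F] M) (eN : (Fin (Module.finrank F M) → F) ≃ₗ[F] N),
      ∀ x y, p (eM x) (eN y) = x ⬝ᵥ y := by
  let b := (Module.finBasis F M).equivFun
  refine ⟨b.symm, (dotProductEquiv F _).trans (b.dualMap.trans p.flip.toPerfPair.symm),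
    fun x y => ?_⟩
  simp [dotProduct_comm]

/-- For a CSS code `(C_X, C_Z)` in `F^d` with complements
`C_X = W_X ⊕ C_Z^⊥` and `C_Z = W_Z ⊕ C_X^⊥`, the standard bilinear form is nondegenerate
on `W_X × W_Z`; consequently `dim W_X = dim W_Z =: k` and there are duality-preserving
`F`-linear isomorphisms `φ_X : F^k ≃ W_X`, `φ_Z : F^k ≃ W_Z`. -/
theorem stmt0 (F : Type*) [Field F] (d : ℕ) (hd : 0 < d)
    (CX CZ WX WZ : Submodule F (Fin d → F))
    (hZX : orth CZ ≤ CX) (hXZ : orth CX ≤ CZ)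
    (hWXsup : WX ⊔ orth CZ = CX) (hWXinf : WX ⊓ orth CZ = ⊥)
    (hWZsup : WZ ⊔ orth CX = CZ) (hWZinf : WZ ⊓ orth CX = ⊥) :
    (∀ x ∈ WX, x ≠ 0 → ∃ y ∈ WZ, dotp F x y ≠ 0) ∧
    (∀ y ∈ WZ, y ≠ 0 → ∃ x ∈ WX, dotp F x y ≠ 0) ∧
    Module.finrank F WX = Module.finrank F WZ ∧
    ∃ (φX : (Fin (Module.finrank F WX) → F) →ₗ[F] (Fin d → F))
      (φZ : (Fin (Module.finrank F WX) → F) →ₗ[F] (Fin d → F)),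
      Function.Injective φX ∧ Function.Injective φZ ∧
      LinearMap.range φX = WX ∧ LinearMap.range φZ = WZ ∧
      ∀ x y : Fin (Module.finrank F WX) → F, dotp F (φX x) (φZ y) = dotp F x y := by
  have hX : WX ≤ CX := hWXsup ▸ le_sup_left
  have hZ : WZ ≤ CZ := hWZsup ▸ le_sup_left
  have nX := exists_dotp_ne_zero hX hWXinf hWZsup
  have nZ := exists_dotp_ne_zero hZ hWZinf hWXsup
  let p : WX →ₗ[F] WZ →ₗ[F] F := (DotSpace.dot (F := F)).domRestrict₁₂ WX WZ
  have hp (x : WX) (y : WZ) : p x y = dotp F (x : Fin d → F) (y : Fin d → F) := rfl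
  have : p.IsPerfPair := by
    refine .of_injective ((injective_iff_map_eq_zero _).2 fun x hx => ?_)
      ((injective_iff_map_eq_zero _).2 fun y hy => ?_)
    · by_contra h
      obtain ⟨y, hy, hxy⟩ := nX x x.2 (by simpa using h)
      exact hxy (LinearMap.congr_fun hx ⟨y, hy⟩)
    · by_contra h
      obtain ⟨x, hx, hxy⟩ := nZ y y.2 (by simpa using h)
      exact hxy ((dotp_comm _ _).trans (LinearMap.congr_fun hy ⟨x, hx⟩))
  obtain ⟨eX, eZ, he⟩ := LinearMap.IsPerfPair.exists_equiv_dotProduct p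
  refine ⟨nX, fun y hy hy0 => ?_, Module.finrank_of_isPerfPair p,
    WX.subtype ∘ₗ eX.toLinearMap, WZ.subtype ∘ₗ eZ.toLinearMap,
    WX.injective_subtype.comp eX.injective, WZ.injective_subtype.comp eZ.injective,
    by simp [LinearMap.range_comp], by simp [LinearMap.range_comp], he⟩
  obtain ⟨x, hx, h⟩ := nZ y hy hy0
  exact ⟨x, hx, dotp_comm x y ▸ h⟩
end

section
/- Let F be a finite field and K a finite field extension of F of degree b, and let φ_X, φ_Z : K → F^b be F-linear bijections such that Tr_{K/F}(x·y) = Σ_{i=1}^b φ_X(x)_i · φ_Z(y)_i for all x, y ∈ K, where Tr_{K/F} is the field trace. Let n be a positive integer and C ⊆ K^n a K-linear subspace, and let φ̃_X, φ̃_Z : K^n → (F^b)^n ≅ F^{bn} denote coordinatewise application of φ_X resp. φ_Z. Then the orthogonal complement of the F-subspace φ̃_Z(C) inside F^{bn}, taken with respect to the standard F-bilinear form ⟨u,v⟩ = Σ_i u_i v_i, equals φ̃_X(C^⊥), where C^⊥ = {u ∈ K^n : Σ_{i=1}^n u_i v_i = 0 for all v ∈ C} is the orthogonal complement with respect to the standard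 K-bilinear form on K^n. -/
open scoped BigOperators

/-- Coordinatewise application of a linear map `φ` to vectors indexed by `ι`. -/
def coordwise {F : Type*} [Field F] {ι : Type*} {M N : Type*} [AddCommGroup M] [Module F M]
    [AddCommGroup N] [Module F N] (φ : M →ₗ[F] N) : (ι → M) →ₗ[F] (ι → N) :=
  LinearMap.pi fun i => φ.comp (LinearMap.proj i)

theorem dotp_self_field (F : Type*) [Field F] (x y : F) : dotp F x y = x * y := rfl

theorem dotp_pi (F : Type*) [Field F] {ι : Type*} [Fintype ι] {M : Type*} [AddCommGroup M]
    [Module F M] [DotSpace F M] (u v : ι → M) : dotp F u v = ∑ i, dotp F (u i) (v i) := rfl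

theorem mem_orth {F : Type*} [Field F] {M : Type*} [AddCommGroup M] [Module F M] [DotSpace F M]
    {V : Submodule F M} {w : M} : w ∈ orth V ↔ ∀ v ∈ V, dotp F v w = 0 := Iff.rfl

theorem coordwise_apply {F : Type*} [Field F] {ι : Type*} {M N : Type*} [AddCommGroup M]
    [Module F M] [AddCommGroup N] [Module F N] (φ : M →ₗ[F] N) (u : ι → M) (i : ι) :
    coordwise φ u i = φ (u i) := rfl

theorem coordwise_surjective {F : Type*} [Field F] {ι : Type*} {M N : Type*} [AddCommGroup M]
    [Module F M] [AddCommGroup N] [Module F N] {φ : M →ₗ[F] N} (hφ : Function.Surjective φ) :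
    Function.Surjective (coordwise (ι := ι) φ) := fun w => by
  choose u hu using fun i => hφ (w i)
  exact ⟨u, funext hu⟩

theorem coordwise_injective {F : Type*} [Field F] {ι : Type*} {M N : Type*} [AddCommGroup M]
    [Module F M] [AddCommGroup N] [Module F N] {φ : M →ₗ[F] N} (hφ : Function.Injective φ) :
    Function.Injective (coordwise (ι := ι) φ) := fun _ _ h =>
  funext fun i => hφ (congrFun h i)

/-- Dual maps for the trace form turn the standard `F`-form into the trace of the standard
`K`-form. -/
theorem dotp_coordwise_eq_trace {F K ι κ : Type*} [Field F] [Field K] [Algebra F K] [Fintype ι]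
    [Fintype κ] {φX φZ : K →ₗ[F] (κ → F)}
    (htr : ∀ x y : K, Algebra.trace F K (x * y) = ∑ i, φX x i * φZ y i) (v u : ι → K) :
    dotp F (coordwise φZ v) (coordwise φX u) = Algebra.trace F K (dotp K v u) := by
  simp only [dotp_pi, dotp_self_field, coordwise_apply, map_sum]
  refine Finset.sum_congr rfl fun i _ => ?_
  rw [mul_comm (v i), htr]
  exact Finset.sum_congr rfl fun j _ => mul_comm _ _

/-- A `K`-linear space is orthogonal to `u` as soon as all the traces of its products with `u`
vanish. -/
theorem mem_orth_iff_trace {F K ι : Type*} [Field F] [Field K] [Algebra F K]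
    [FiniteDimensional F K] [Algebra.IsSeparable F K] [Fintype ι] {C : Submodule K (ι → K)}
    {u : ι → K} : u ∈ orth C ↔ ∀ v ∈ C, Algebra.trace F K (dotp K v u) = 0 := by
  refine ⟨fun h v hv => by rw [h v hv, map_zero], fun h v hv => ?_⟩
  refine (traceForm_nondegenerate F K).1 _ fun c => ?_
  have hc : dotp K (c • v) u = dotp K v u * c := by
    simp [dotp, mul_comm]
  rw [Algebra.traceForm_apply, ← hc]
  exact h _ (C.smul_mem c hv)

/-- Let `K/F` be a degree-`b` extension of finite fields and
`φ_X, φ_Z : K → F^b` be `F`-linear bijections with `Tr_{K/F}(xy) = ⟨φ_X x, φ_Z y⟩`.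
For a `K`-linear subspace `C ⊆ K^n`, the `F`-orthogonal complement of `φ̃_Z(C)` in
`(F^b)^n ≅ F^{bn}` equals `φ̃_X(C^⊥)`, where `C^⊥` is the `K`-orthogonal complement. -/
theorem stmt1 (F K : Type*) [Field F] [Field K] [Algebra F K] [Fintype F] [Fintype K]
    (b : ℕ) (hb : Module.finrank F K = b)
    (φX φZ : K →ₗ[F] (Fin b → F))
    (hXbij : Function.Bijective φX) (hZbij : Function.Bijective φZ)
    (htr : ∀ x y : K, Algebra.trace F K (x * y) = ∑ i, φX x i * φZ y i)
    (n : ℕ) (hn : 0 < n) (C : Submodule K (Fin n → K)) :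
    orth (Submodule.map (coordwise (ι := Fin n) φZ) (C.restrictScalars F))
      = Submodule.map (coordwise (ι := Fin n) φX) ((orth C).restrictScalars F) := by
  ext w
  obtain ⟨u, rfl⟩ := coordwise_surjective hXbij.surjective w
  have hu : coordwise φX u ∈ Submodule.map (coordwise φX) ((orth C).restrictScalars F) ↔
      u ∈ orth C :=
    (coordwise_injective hXbij.injective).mem_set_image
  rw [hu, mem_orth_iff_trace (F := F), mem_orth]
  simp only [Submodule.mem_map, Submodule.restrictScalars_mem, forall_exists_index, and_imp,
    forall_apply_eq_imp_iff₂, dotp_coordwise_eq_trace htr]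
end

section
/- Fix a prime power q, positive integers n, d, b, a real δ_in ∈ [0,1], and Σ = F_q^b. Let C_X, C_Z ⊆ Σ^d be F_q-linear subspaces with C_Z^⊥ ⊆ C_X (orthogonal complement with respect to the standard F_q-bilinear form on F_q^{bd}), and suppose every c ∈ C_X \ C_Z^⊥ has at least δ_in·d nonzero Σ-coordinates. Let G = (L,R,E) be a d-regular bipartite graph with |L| = |R| = n satisfying the λ-expander mixing property. Let z, h ∈ Σ^E be such that z_ℓ ∈ C_X and h_ℓ ∈ C_X for every ℓ ∈ L, and suppose Δ_{L,⊥}(z,h) := (1/n)·|{ℓ ∈ L : z_ℓ − h_ℓ ∉ C_Z^⊥}| > 0. Then Δ_R(z,h) := (1/n)·|{r ∈ R : z_r ≠ h_r}| ≥ δ_in − λ/Δ_{L,⊥}(z,h). -/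
open scoped BigOperators

open scoped BigOperators

/-- A `d`-regular bipartite (multi)graph with left vertices `L`, right vertices `R` and
edge set `E`: each edge `e` has a left endpoint `eL e` and a right endpoint `eR e`, and
each vertex comes with a fixed ordering of the `d` edges incident to it. -/
structure BipartiteGraph (L R E : Type*) (d : ℕ) where
  eL : E → L
  eR : E → R
  oL : (ℓ : L) → Fin d ≃ {e : E // eL e = ℓ}
  oR : (r : R) → Fin d ≃ {e : E // eR e = r}

namespace BipartiteGraph

variable {L R E : Type*} {d : ℕ}

/-- The block of `z : E → A` at a left vertex `ℓ`, an element of `A^d`. -/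
def blockL {A : Type*} (G : BipartiteGraph L R E d) (z : E → A) (ℓ : L) : Fin d → A :=
  fun i => z (G.oL ℓ i).1

/-- The block of `z : E → A` at a right vertex `r`, an element of `A^d`. -/
def blockR {A : Type*} (G : BipartiteGraph L R E d) (z : E → A) (r : R) : Fin d → A :=
  fun i => z (G.oR r i).1

/-- The `λ`-expander mixing property: for all `f : L → ℝ`, `g : R → ℝ`,
`|E_{(ℓ,r) ∈ E}[f(ℓ)g(r)] − E_ℓ[f]·E_r[g]| ≤ λ √(E_ℓ[f²]) √(E_r[g²])`. -/
def EML [Fintype L] [Fintype R] [Fintype E] (G : BipartiteGraph L R E d) (lam : ℝ) : Prop :=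
  ∀ (f : L → ℝ) (g : R → ℝ),
    |(∑ e, f (G.eL e) * g (G.eR e)) / (Fintype.card E : ℝ) -
        ((∑ ℓ, f ℓ) / (Fintype.card L : ℝ)) * ((∑ r, g r) / (Fintype.card R : ℝ))| ≤
      lam * Real.sqrt ((∑ ℓ, f ℓ ^ 2) / (Fintype.card L : ℝ)) *
        Real.sqrt ((∑ r, g r ^ 2) / (Fintype.card R : ℝ))

end BipartiteGraph

namespace BipartiteGraph

variable {L R E : Type*} {d : ℕ}

theorem sum_edges_eq_sum_left [Fintype L] [Fintype E] (G : BipartiteGraph L R E d)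
    (φ : E → ℝ) : ∑ e, φ e = ∑ ℓ, ∑ i, φ (G.oL ℓ i).1 := by
  classical
  rw [← (Equiv.sigmaFiberEquiv G.eL).sum_comp, Fintype.sum_sigma]
  exact Finset.sum_congr rfl fun ℓ _ => ((G.oL ℓ).sum_comp fun e => φ e.1).symm

theorem card_edges [Fintype L] [Fintype E] (G : BipartiteGraph L R E d) :
    (Fintype.card E : ℝ) = Fintype.card L * d := by
  simpa using G.sum_edges_eq_sum_left fun _ => 1

theorem EML.nonneg [Fintype L] [Fintype R] [Fintype E] [Nonempty L] [Nonempty R]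
    {G : BipartiteGraph L R E d} {lam : ℝ} (hG : G.EML lam) : 0 ≤ lam := by
  have key := hG (fun _ => 1) (fun _ => 1)
  have hL : (Fintype.card L : ℝ) ≠ 0 := by simp
  have hR : (Fintype.card R : ℝ) ≠ 0 := by simp
  have h1 := (abs_nonneg _).trans key
  simpa [hL, hR] using h1

end BipartiteGraph

theorem sum_indicator_one_eq_ncard {V : Type*} [Fintype V] (U : Set V) :
    ∑ v, U.indicator (fun _ => (1 : ℝ)) v = U.ncard := by
  classical
  simp_rw [Set.indicator_apply]
  rw [Finset.sum_boole, Set.filter_mem_univ_eq_toFinset, Set.ncard_eq_toFinset_card']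

theorem sqrt_mean_indicator_sq_le_one {V : Type*} [Fintype V] (U : Set V) :
    √((∑ v, U.indicator (fun _ => (1 : ℝ)) v ^ 2) / (Fintype.card V : ℝ)) ≤ 1 := by
  refine Real.sqrt_le_one.mpr ?_
  refine div_le_one_of_le₀ ?_ (Nat.cast_nonneg _)
  refine (Finset.sum_le_card_nsmul _ _ 1 fun v _ => ?_).trans (by simp)
  by_cases hv : v ∈ U <;> simp [hv]

namespace BipartiteGraph

variable {L R E : Type*} {d : ℕ}

theorem EML.sum_indicator_le [Fintype L] [Fintype R] [Fintype E] [Nonempty L] [Nonempty R]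
    {G : BipartiteGraph L R E d} {lam : ℝ} (hG : G.EML lam) (S : Set L) (T : Set R) :
    (∑ e, S.indicator (fun _ => (1 : ℝ)) (G.eL e) * T.indicator (fun _ => (1 : ℝ)) (G.eR e)) /
        (Fintype.card E : ℝ) ≤
      S.ncard / (Fintype.card L : ℝ) * (T.ncard / (Fintype.card R : ℝ)) + lam := by
  have key := (le_abs_self _).trans
    (hG (S.indicator fun _ => (1 : ℝ)) (T.indicator fun _ => (1 : ℝ)))
  rw [sum_indicator_one_eq_ncard, sum_indicator_one_eq_ncard, mul_assoc] at key
  have hle : √((∑ ℓ, S.indicator (fun _ => (1 : ℝ)) ℓ ^ 2) / (Fintype.card L : ℝ)) *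
      √((∑ r, T.indicator (fun _ => (1 : ℝ)) r ^ 2) / (Fintype.card R : ℝ)) ≤ 1 :=
    mul_le_one₀ (sqrt_mean_indicator_sq_le_one S) (Real.sqrt_nonneg _)
      (sqrt_mean_indicator_sq_le_one T)
  linarith [mul_le_of_le_one_right hG.nonneg hle]

/-- If each left vertex of `S` has at least `c` incident edges on which `z` and `h` differ, then
at least `c * |S|` edges join `S` to the right vertices on whose blocks `z` and `h` differ. -/
theorem mul_ncard_le_sum_indicator [Fintype L] [Fintype E] {A : Type*}
    (G : BipartiteGraph L R E d) (z h : E → A) (S : Set L) (c : ℝ)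
    (hS : ∀ ℓ ∈ S, c ≤ ({i | G.blockL z ℓ i ≠ G.blockL h ℓ i} : Set (Fin d)).ncard) :
    c * S.ncard ≤ ∑ e, S.indicator (fun _ => (1 : ℝ)) (G.eL e) *
      {r | G.blockR z r ≠ G.blockR h r}.indicator (fun _ => (1 : ℝ)) (G.eR e) := by
  have hT : ∀ e, z e ≠ h e → G.eR e ∈ {r | G.blockR z r ≠ G.blockR h r} := fun e he heq => by
    have := congrFun heq ((G.oR (G.eR e)).symm ⟨e, rfl⟩)
    exact he (by simpa [blockR] using this)
  rw [G.sum_edges_eq_sum_left, ← sum_indicator_one_eq_ncard, Finset.mul_sum]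
  refine Finset.sum_le_sum fun ℓ _ => ?_
  simp only [(G.oL ℓ _).2]
  rw [← Finset.mul_sum]
  by_cases hℓ : ℓ ∈ S
  · simp only [Set.indicator_of_mem hℓ, mul_one, one_mul]
    refine (hS ℓ hℓ).trans ?_
    rw [← sum_indicator_one_eq_ncard]
    refine Finset.sum_le_sum fun i _ => ?_
    by_cases hi : z (G.oL ℓ i).1 = h (G.oL ℓ i).1
    · rw [Set.indicator_of_notMem (by simpa [blockL] using hi)]
      exact Set.indicator_nonneg (fun _ _ => zero_le_one) _
    · rw [Set.indicator_of_mem (hT _ hi)]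
      exact Set.indicator_le_self' (fun _ _ => zero_le_one) _
  · simp [hℓ]

end BipartiteGraph

/-- (Distance proof of AEL.) Suppose every `c ∈ C_X \ C_Z^⊥` has at
least `δ_in·d` nonzero `Σ`-coordinates, `G` satisfies the `λ`-mixing property, all left
blocks of `z, h` lie in `C_X`, and `Δ_{L,⊥}(z,h) > 0`. Then
`Δ_R(z,h) ≥ δ_in − λ / Δ_{L,⊥}(z,h)`. -/
theorem stmt5 (F : Type*) [Field F] [Fintype F]
    (L R E : Type*) [Fintype L] [Fintype R] [Fintype E]
    (n d b : ℕ) (hn : 0 < n) (hd : 0 < d)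
    (hL : Fintype.card L = n) (hR : Fintype.card R = n)
    (G : BipartiteGraph L R E d)
    (δin : ℝ) (hδ0 : 0 ≤ δin) (hδ1 : δin ≤ 1)
    (CX CZ : Submodule F (Fin d → Fin b → F)) (hCZX : orth CZ ≤ CX)
    (hdist : ∀ c ∈ CX, c ∉ orth CZ →
      δin * d ≤ (({i : Fin d | c i ≠ 0} : Set (Fin d)).ncard : ℝ))
    (lam : ℝ) (hEML : G.EML lam)
    (z h : E → (Fin b → F))
    (hzC : ∀ ℓ : L, G.blockL z ℓ ∈ CX) (hhC : ∀ ℓ : L, G.blockL h ℓ ∈ CX)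
    (hpos : 0 < ((({ℓ : L | G.blockL z ℓ - G.blockL h ℓ ∉ orth CZ} : Set L).ncard : ℝ) / n)) :
    ((({r : R | G.blockR z r ≠ G.blockR h r} : Set R).ncard : ℝ) / n)
      ≥ δin - lam /
        ((({ℓ : L | G.blockL z ℓ - G.blockL h ℓ ∉ orth CZ} : Set L).ncard : ℝ) / n) := by
  have : Nonempty L := Fintype.card_pos_iff.mp (hL ▸ hn)
  have : Nonempty R := Fintype.card_pos_iff.mp (hR ▸ hn)
  set S : Set L := {ℓ : L | G.blockL z ℓ - G.blockL h ℓ ∉ orth CZ} with hS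
  set T : Set R := {r : R | G.blockR z r ≠ G.blockR h r} with hT
  have hn' : (0 : ℝ) < n := Nat.cast_pos.mpr hn
  have hd' : (0 : ℝ) < d := Nat.cast_pos.mpr hd
  have hlow := G.mul_ncard_le_sum_indicator z h S (δin * d) fun ℓ hℓ => by
    simpa [sub_eq_zero] using hdist _ (CX.sub_mem (hzC ℓ) (hhC ℓ)) hℓ
  have hmix := hEML.sum_indicator_le S T
  rw [G.card_edges, hL, hR] at hmix
  have hmean : δin * (S.ncard / n : ℝ) ≤ S.ncard / n * (T.ncard / n) + lam :=
    calc δin * (S.ncard / n : ℝ) = δin * d * S.ncard / (n * d) := by field_simp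
      _ ≤ _ := (div_le_div_of_nonneg_right hlow (by positivity)).trans hmix
  rw [ge_iff_le, sub_le_iff_le_add, ← mul_le_mul_iff_left₀ hpos, add_mul,
    div_mul_cancel₀ _ hpos.ne']
  linarith
end

section
/- Let H be a real inner product space, K ⊆ H a convex set, w ∈ H with ‖w‖ ≤ 1, and α ∈ (0,1). Suppose g₀ ∈ K satisfies ⟨g₀, w⟩ > α and ‖g₀‖ ≤ ‖v‖ for every v ∈ K with ⟨v, w⟩ > α (i.e., g₀ is a minimum-norm point of {v ∈ K : ⟨v,w⟩ > α}). Then every h ∈ K with ‖h‖ ≤ 1 and ⟨h, w⟩ > α satisfies ⟨g₀, h⟩ > α². -/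
open scoped RealInnerProductSpace

/-- A minimum-norm point `g` of a convex set `S` satisfies `‖g‖² ≤ ⟨g,h⟩` for all `h ∈ S`. -/
theorem norm_sq_le_inner_of_forall_norm_le {H : Type*} [NormedAddCommGroup H]
    [InnerProductSpace ℝ H] {S : Set H} (hS : Convex ℝ S) {g : H} (hg : g ∈ S)
    (hmin : ∀ v ∈ S, ‖g‖ ≤ ‖v‖) {h : H} (hh : h ∈ S) : ‖g‖ ^ 2 ≤ ⟪g, h⟫ := by
  have : Nonempty S := ⟨⟨g, hg⟩⟩
  have hinf : ‖0 - g‖ = ⨅ v : S, ‖0 - (v : H)‖ := by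
    refine le_antisymm (le_ciInf fun v => ?_)
      (ciInf_le ⟨0, by rintro _ ⟨v, rfl⟩; exact norm_nonneg _⟩ (⟨g, hg⟩ : S))
    simpa using hmin v v.2
  have hle := (norm_eq_iInf_iff_real_inner_le_zero hS hg).1 hinf h hh
  rw [zero_sub, inner_neg_left, inner_sub_right, real_inner_self_eq_norm_sq] at hle
  linarith

/-- (Geometric core of the covering lemma.) Let `K` be a convex subset
of a real inner product space, `‖w‖ ≤ 1`, `α ∈ (0,1)`, and let `g₀` be a minimum-norm
point of `{v ∈ K : ⟨v,w⟩ > α}`. Then every `h ∈ K` with `‖h‖ ≤ 1` and `⟨h,w⟩ > α`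
satisfies `⟨g₀,h⟩ > α²`. -/
theorem stmt12 (H : Type*) [NormedAddCommGroup H] [InnerProductSpace ℝ H]
    (K : Set H) (hK : Convex ℝ K)
    (w : H) (hw : ‖w‖ ≤ 1)
    (α : ℝ) (hα0 : 0 < α) (hα1 : α < 1)
    (g₀ : H) (hg₀K : g₀ ∈ K) (hg₀w : α < ⟪g₀, w⟫)
    (hmin : ∀ v ∈ K, α < ⟪v, w⟫ → ‖g₀‖ ≤ ‖v‖) :
    ∀ h ∈ K, ‖h‖ ≤ 1 → α < ⟪h, w⟫ → α ^ 2 < ⟪g₀, h⟫ := by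
  intro h hhK _ hhw
  have hconv : Convex ℝ (K ∩ {v | α < ⟪v, w⟫}) :=
    hK.inter (convex_halfSpace_gt
      ⟨fun x y => inner_add_left x y w, fun c x => real_inner_smul_left x w c⟩ α)
  have hnorm : α < ‖g₀‖ :=
    hg₀w.trans_le ((real_inner_le_norm g₀ w).trans
      (mul_le_of_le_one_right (norm_nonneg g₀) hw))
  calc α ^ 2 < ‖g₀‖ ^ 2 := by gcongr
    _ ≤ ⟪g₀, h⟫ := norm_sq_le_inner_of_forall_norm_le hconv ⟨hg₀K, hg₀w⟩
        (fun v hv => hmin v hv.1 hv.2) ⟨hhK, hhw⟩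
end

section
/- Let Γ be a finite nonempty set, n a positive integer, C ⊆ Γ^n a finite nonempty set, g ∈ Γ^n, and α ∈ (0,1). Then there exist m ≤ |Γ|·n + 1 elements f_1, …, f_m ∈ C and nonnegative reals p_1, …, p_m with Σ_i p_i = 1 such that for every h ∈ C with Δ(g,h) < (1−α)·n it holds that Σ_{i=1}^m p_i · Δ(f_i, h) < (1−α²)·n, where Δ denotes Hamming distance on Γ^n. -/
open scoped BigOperators

/-- The one-hot encoding of a word, as a vector in Euclidean space. -/
noncomputable def oneHot {ι Γ : Type*} [DecidableEq Γ] (u : ι → Γ) :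
    EuclideanSpace ℝ (ι × Γ) :=
  WithLp.toLp 2 fun x => if u x.1 = x.2 then 1 else 0

theorem inner_oneHot {ι Γ : Type*} [Fintype ι] [Fintype Γ] [DecidableEq Γ] (u v : ι → Γ) :
    inner ℝ (oneHot u) (oneHot v) = (Fintype.card ι : ℝ) - hammingDist u v := by
  have hcard := Finset.card_filter_add_card_filter_not (s := Finset.univ) (fun i => u i = v i)
  have hinner : inner ℝ (oneHot u) (oneHot v) = ∑ i, if u i = v i then (1 : ℝ) else 0 := by
    simp [oneHot, PiLp.inner_apply, Fintype.sum_prod_type, eq_comm]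
  rw [hinner, Finset.sum_boole, eq_sub_iff_add_eq, hammingDist]
  exact_mod_cast hcard

/-- A nonempty compact convex set has a point `w` whose inner product with every point of the
set is at least `‖w‖ ^ 2`. -/
theorem IsCompact.exists_norm_sq_le_inner {E : Type*} [NormedAddCommGroup E]
    [InnerProductSpace ℝ E] {K : Set E} (hK : IsCompact K) (hne : K.Nonempty)
    (hconv : Convex ℝ K) : ∃ w ∈ K, ∀ x ∈ K, ‖w‖ ^ 2 ≤ inner ℝ w x := by
  obtain ⟨w, hw, hmin⟩ := exists_norm_eq_iInf_of_complete_convex hne hK.isComplete hconv 0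
  refine ⟨w, hw, fun x hx => ?_⟩
  have h := (norm_eq_iInf_iff_real_inner_le_zero hconv hw).1 hmin x hx
  rw [zero_sub, inner_neg_left, inner_sub_right, real_inner_self_eq_norm_sq] at h
  linarith

/-- If every point of a finite nonempty set has inner product more than `c` with `g`, some convex
combination of the set has inner product more than `a` with all of its points, provided
`a * ‖g‖ ^ 2 ≤ c ^ 2`. -/
theorem Set.Finite.exists_mem_convexHull_forall_lt_inner {E : Type*} [NormedAddCommGroup E]
    [InnerProductSpace ℝ E] {s : Set E} (hs : s.Finite) (hne : s.Nonempty) {g : E} {a c : ℝ}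
    (hc : 0 ≤ c) (hac : a * ‖g‖ ^ 2 ≤ c ^ 2) (hg : ∀ x ∈ s, c < inner ℝ g x) :
    ∃ w ∈ convexHull ℝ s, ∀ x ∈ s, a < inner ℝ w x := by
  obtain ⟨w, hw, hwx⟩ := (hs.isCompact_convexHull ℝ).exists_norm_sq_le_inner hne.convexHull
    (convex_convexHull ℝ s)
  refine ⟨w, hw, fun x hx => lt_of_lt_of_le ?_ (hwx x (subset_convexHull ℝ s hx))⟩
  have hgw : c < inner ℝ g w :=
    convexHull_min hg (convex_halfSpace_gt (innerₛₗ ℝ g).isLinear c) hw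
  have hlt : c < ‖g‖ * ‖w‖ := hgw.trans_le (real_inner_le_norm g w)
  have hsq : c ^ 2 < ‖g‖ ^ 2 * ‖w‖ ^ 2 := by
    rw [← mul_pow]
    exact pow_lt_pow_left₀ hlt hc two_ne_zero
  by_contra! hle
  nlinarith [mul_le_mul_of_nonneg_left hle (sq_nonneg ‖g‖)]

/-- Carathéodory's theorem with an explicit bound on the number of points. -/
theorem exists_fin_convex_combination {E : Type*} [AddCommGroup E] [Module ℝ E]
    [FiniteDimensional ℝ E] {s : Set E} {w : E} (hw : w ∈ convexHull ℝ s) :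
    ∃ (m : ℕ) (z : Fin m → E) (p : Fin m → ℝ), m ≤ Module.finrank ℝ E + 1 ∧
      (∀ i, z i ∈ s) ∧ (∀ i, 0 ≤ p i) ∧ ∑ i, p i = 1 ∧ ∑ i, p i • z i = w := by
  obtain ⟨ι, _, z, p, hz, hind, hp, hsum, hzw⟩ := eq_pos_convex_span_of_mem_convexHull hw
  let e := (Fintype.equivFin ι).symm
  refine ⟨Fintype.card ι, z ∘ e, p ∘ e, ?_, fun i => hz ⟨e i, rfl⟩, fun i => (hp _).le, ?_, ?_⟩
  · exact hind.card_le_finrank_succ.trans (Nat.succ_le_succ (Submodule.finrank_le _))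
  · rw [← hsum]
    exact e.sum_comp p
  · rw [← hzw]
    exact e.sum_comp fun i => p i • z i

/-- (Covering lemma.) For any finite nonempty code `C ⊆ Γ^n`, any
`g ∈ Γ^n` and `α ∈ (0,1)`, there is a distribution supported on at most `|Γ|·n + 1`
codewords of `C` such that every `h ∈ C` with `Δ(g,h) < (1−α)n` has average distance
less than `(1−α²)n` from the distribution. -/
theorem stmt13 (Γ : Type*) [Fintype Γ] [Nonempty Γ] [DecidableEq Γ]
    (n : ℕ) (hn : 0 < n)
    (C : Finset (Fin n → Γ)) (hC : C.Nonempty)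
    (g : Fin n → Γ) (α : ℝ) (hα0 : 0 < α) (hα1 : α < 1) :
    ∃ (m : ℕ) (f : Fin m → (Fin n → Γ)) (p : Fin m → ℝ),
      m ≤ Fintype.card Γ * n + 1 ∧
      (∀ i, f i ∈ C) ∧
      (∀ i, 0 ≤ p i) ∧ (∑ i, p i) = 1 ∧
      ∀ h ∈ C, (hammingDist g h : ℝ) < (1 - α) * n →
        (∑ i, p i * (hammingDist (f i) h : ℝ)) < (1 - α ^ 2) * n := by
  set S : Finset (Fin n → Γ) := C.filter fun h => (hammingDist g h : ℝ) < (1 - α) * n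
  rcases S.eq_empty_or_nonempty with hempty | hne
  · obtain ⟨c, hc⟩ := hC
    refine ⟨1, fun _ => c, fun _ => 1, by omega, fun _ => hc, fun _ => zero_le_one, by simp, ?_⟩
    intro h hh hlt
    have hmem : h ∈ S := Finset.mem_filter.2 ⟨hh, hlt⟩
    simp [hempty] at hmem
  have hinner (u v : Fin n → Γ) : inner ℝ (oneHot u) (oneHot v) = (n : ℝ) - hammingDist u v := by
    simpa using inner_oneHot u v
  have hnorm : ‖oneHot g‖ ^ 2 = (n : ℝ) := by
    rw [← real_inner_self_eq_norm_sq, hinner]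
    simp
  obtain ⟨w, hw, hlt⟩ := (S.finite_toSet.image oneHot).exists_mem_convexHull_forall_lt_inner
    (Finset.coe_nonempty.2 hne |>.image _) (g := oneHot g) (a := α ^ 2 * n) (c := α * n)
    (by positivity) (by rw [hnorm]; linarith) (by
      rintro _ ⟨h, hh, rfl⟩
      have := (Finset.mem_filter.1 hh).2
      rw [hinner]
      linarith)
  obtain ⟨m, z, p, hm, hz, hp, hsum, rfl⟩ := exists_fin_convex_combination hw
  choose f hf hfz using hz
  refine ⟨m, f, p, ?_, fun i => (Finset.mem_filter.1 (hf i)).1, hp, hsum, fun h hh hgh => ?_⟩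
  · simpa [mul_comm] using hm
  · have key := hlt _ ⟨h, Finset.mem_filter.2 ⟨hh, hgh⟩, rfl⟩
    simp only [← hfz, sum_inner, real_inner_smul_left, hinner, mul_sub, Finset.sum_sub_distrib,
      ← Finset.sum_mul, hsum] at key
    linarith
end

section
/- Let Γ be a finite abelian group, n a positive integer, δ ∈ (0,1], and let B ⊆ A be additive subgroups of Γ^n such that every c ∈ A \ B has at least δ·n nonzero coordinates. Then for every g ∈ Γ^n, the number of cosets of B in A that contain an element h with Δ(g,h) < (1 − √(1−δ))·n is at most |Γ|·n + 1, where Δ denotes Hamming distance on Γ^n. -/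
open scoped BigOperators

/-- The indicator vector of the graph of `x`. -/
def graphIndicator {κ Γ : Type*} [DecidableEq Γ] (x : κ → Γ) : κ × Γ → ℝ :=
  fun p ↦ if x p.1 = p.2 then 1 else 0

theorem graphIndicator_dotProduct {κ Γ : Type*} [Fintype κ] [Fintype Γ] [DecidableEq Γ]
    (x y : κ → Γ) :
    graphIndicator x ⬝ᵥ graphIndicator y = Fintype.card κ - (hammingDist x y : ℝ) := by
  have hcount := Finset.card_filter_add_card_filter_not
    (s := (Finset.univ : Finset κ)) (fun i ↦ x i = y i)
  rw [Finset.card_univ] at hcount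
  have hagree : graphIndicator x ⬝ᵥ graphIndicator y =
      (Finset.card {i : κ | x i = y i} : ℝ) := by
    simp [graphIndicator, dotProduct, Fintype.sum_prod_type, eq_comm]
  rw [hagree, hammingDist, ← hcount]
  push_cast
  ring

/-- The alphabet-size form of the Johnson bound: a family of words with pairwise distance at least
`δ n` has at most `n |Γ|` members strictly within the Johnson radius of a given word. -/
theorem card_le_of_hammingDist_lt_johnson {ι κ Γ : Type*} [Fintype ι] [Fintype κ] [Fintype Γ]
    [DecidableEq Γ] {δ : ℝ} (hδ : δ ≤ 1) (h : ι → κ → Γ) (g : κ → Γ)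
    (hdist : Pairwise fun i j ↦ δ * Fintype.card κ ≤ hammingDist (h i) (h j))
    (hg : ∀ i, (hammingDist g (h i) : ℝ) < (1 - √(1 - δ)) * Fintype.card κ) :
    Fintype.card ι ≤ Fintype.card κ * Fintype.card Γ := by
  set α := √(1 - δ) with hα
  have hα0 : 0 ≤ α := Real.sqrt_nonneg _
  have hα2 : α * α = 1 - δ := Real.mul_self_sqrt (by linarith)
  let F : LinearMap.BilinForm ℝ (κ × Γ → ℝ) := dotProductBilin ℝ ℝ
  have hF (v w : κ × Γ → ℝ) : F v w = v ⬝ᵥ w := rfl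
  have hpos : F.toQuadraticMap.PosDef := fun v hv ↦ by
    rw [LinearMap.BilinMap.toQuadraticMap_apply, hF]
    simpa using Matrix.dotProduct_self_star_pos_iff.2 hv
  have hli := F.linearIndependent_of_pairwise_le_zero hpos (F (graphIndicator g))
    (fun i ↦ graphIndicator (h i) - α • graphIndicator g) (fun i ↦ ?_) (fun i j hij ↦ ?_)
  · simpa using hli.fintype_card_le_finrank
  · simp only [hF, dotProduct_sub, dotProduct_smul, graphIndicator_dotProduct, hammingDist_self,
      smul_eq_mul]
    have := hg i
    push_cast
    linarith
  · simp only [hF, dotProduct_sub, sub_dotProduct, dotProduct_smul, smul_dotProduct,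
      graphIndicator_dotProduct, hammingDist_self, smul_eq_mul, hammingDist_comm (h i) g]
    have hi := mul_le_mul_of_nonneg_left (hg i).le hα0
    have hj := mul_le_mul_of_nonneg_left (hg j).le hα0
    have hd := hdist hij
    push_cast
    linear_combination hi + hj + hd - (Fintype.card κ : ℝ) * hα2

/-- (Alphabet-free Johnson bound for CSS-type codes.) Let `B ⊆ A` be
additive subgroups of `Γ^n` such that every `c ∈ A \ B` has at least `δ·n` nonzero
coordinates. Then for every `g ∈ Γ^n`, the number of cosets of `B` (in the quotient
`Γ^n ⧸ B`) containing some `h ∈ A` with `Δ(g,h) < (1 − √(1−δ))·n` is at most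
`|Γ|·n + 1`. -/
theorem stmt14 (Γ : Type*) [AddCommGroup Γ] [Fintype Γ] [DecidableEq Γ]
    (n : ℕ) (hn : 0 < n)
    (δ : ℝ) (hδ0 : 0 < δ) (hδ1 : δ ≤ 1)
    (A B : AddSubgroup (Fin n → Γ)) (hBA : B ≤ A)
    (hdist : ∀ c ∈ A, c ∉ B →
      δ * n ≤ (({i : Fin n | c i ≠ 0} : Set (Fin n)).ncard : ℝ))
    (g : Fin n → Γ) :
    ({x : (Fin n → Γ) ⧸ B | ∃ h ∈ A, x = QuotientAddGroup.mk h ∧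
        (hammingDist g h : ℝ) < (1 - Real.sqrt (1 - δ)) * n} : Set _).ncard
      ≤ Fintype.card Γ * n + 1 := by
  classical
  set S : Set ((Fin n → Γ) ⧸ B) := {x | ∃ h ∈ A, x = QuotientAddGroup.mk h ∧
    (hammingDist g h : ℝ) < (1 - Real.sqrt (1 - δ)) * n}
  have hS (x : S) : ∃ h ∈ A, x.1 = QuotientAddGroup.mk h ∧
    (hammingDist g h : ℝ) < (1 - Real.sqrt (1 - δ)) * n := x.2
  choose h hA hmk hlt using hS
  have hcard := card_le_of_hammingDist_lt_johnson hδ1 h g (fun x y hxy ↦ ?_)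
    (by simpa using hlt)
  · rw [← Nat.card_coe_set_eq, Nat.card_eq_fintype_card]
    rw [Fintype.card_fin] at hcard
    linarith
  · have hB : -h x + h y ∉ B := fun hmem ↦ hxy <| Subtype.ext <| by
      rw [hmk x, hmk y, QuotientAddGroup.eq]
      exact hmem
    have hd := hdist _ (A.add_mem (A.neg_mem (hA x)) (hA y)) hB
    rw [Set.ncard_eq_toFinset_card', Set.toFinset_ofPred, ← hammingNorm,
      ← hammingDist_eq_hammingNorm] at hd
    simpa using hd
end

section
/- If Ẽ is an η-good degree-4d pseudocodeword (as defined in the context) and h ∈ Σ^E satisfies h_ℓ ∈ C_X for every ℓ ∈ L and Δ_{L,⊥}(Ẽ,h) > 0, then Δ_R(Ẽ,h) ≥ δ_in − (λ + η)/Δ_{L,⊥}(Ẽ,h). -/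
open scoped BigOperators

open scoped BigOperators

/-- The SoS indicator monomial `1_{ℓ,α} = ∏_{i} Z_{(edge i of ℓ), α i}` for a left
vertex `ℓ` and a local assignment `α ∈ Σ^d`. -/
noncomputable def indL {L R E : Type*} {d : ℕ} {A : Type*} (G : BipartiteGraph L R E d)
    (ℓ : L) (α : Fin d → A) : MvPolynomial (E × A) ℝ :=
  ∏ i, MvPolynomial.X ((G.oL ℓ i).1, α i)

/-- The SoS indicator monomial `1_{r,β}` for a right vertex `r` and `β ∈ Σ^d`. -/
noncomputable def indR {L R E : Type*} {d : ℕ} {A : Type*} (G : BipartiteGraph L R E d)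
    (r : R) (β : Fin d → A) : MvPolynomial (E × A) ℝ :=
  ∏ i, MvPolynomial.X ((G.oR r i).1, β i)

open MvPolynomial in
/-- A degree-`4d` pseudoexpectation over assignments `E → A`, without code constraints. -/
structure IsPseudoexpectation {E A : Type*} [Fintype A] (d : ℕ)
    (pE : MvPolynomial (E × A) ℝ →ₗ[ℝ] ℝ) : Prop where
  one : pE 1 = 1
  sq_nonneg : ∀ p : MvPolynomial (E × A) ℝ, p.totalDegree ≤ 2 * d → 0 ≤ pE (p ^ 2)
  boolean : ∀ (e : E) (j : A) (p : MvPolynomial (E × A) ℝ),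
    (p * (X (e, j) ^ 2 - X (e, j))).totalDegree ≤ 4 * d →
    pE (p * (X (e, j) ^ 2 - X (e, j))) = 0
  sum_one : ∀ (e : E) (p : MvPolynomial (E × A) ℝ),
    (p * ((∑ j : A, X (e, j)) - 1)).totalDegree ≤ 4 * d →
    pE (p * ((∑ j : A, X (e, j)) - 1)) = 0

/-- The product of the variables in a multiset. -/
noncomputable def varProd {σ : Type*} (s : Multiset σ) : MvPolynomial σ ℝ :=
  (s.map MvPolynomial.X).prod

section varProd

variable {σ : Type*}

theorem varProd_zero : varProd (0 : Multiset σ) = 1 := by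
  simp [varProd]

theorem varProd_cons (a : σ) (s : Multiset σ) :
    varProd (a ::ₘ s) = MvPolynomial.X a * varProd s := by
  simp [varProd]

theorem varProd_add (s t : Multiset σ) : varProd (s + t) = varProd s * varProd t := by
  simp [varProd]

theorem totalDegree_varProd_le (s : Multiset σ) : (varProd s).totalDegree ≤ s.card := by
  induction s using Multiset.induction_on with
  | empty => simp [varProd_zero]
  | cons a s ih =>
    rw [varProd_cons, Multiset.card_cons]
    refine (MvPolynomial.totalDegree_mul _ _).trans ?_
    rw [MvPolynomial.totalDegree_X]
    omega

theorem prod_X_eq_varProd {ι : Type*} [Fintype ι] (v : ι → σ) :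
    (∏ i, MvPolynomial.X (v i) : MvPolynomial σ ℝ) = varProd (Finset.univ.val.map v) := by
  simp only [varProd, Multiset.map_map]
  rfl

end varProd

namespace IsPseudoexpectation

open MvPolynomial

variable {E A : Type*} [Fintype A] {d : ℕ} {pE : MvPolynomial (E × A) ℝ →ₗ[ℝ] ℝ}

theorem mul_X_sq (hp : IsPseudoexpectation d pE) (p : MvPolynomial (E × A) ℝ) (a : E × A)
    (h : p.totalDegree + 2 ≤ 4 * d) : pE (p * X a ^ 2) = pE (p * X a) := by
  have hX : (X a ^ 2 - X a : MvPolynomial (E × A) ℝ).totalDegree ≤ 2 := by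
    refine (totalDegree_sub _ _).trans (max_le ?_ ?_)
    · exact (totalDegree_pow _ _).trans (by rw [totalDegree_X])
    · rw [totalDegree_X]; omega
  have := hp.boolean a.1 a.2 p ((totalDegree_mul _ _).trans (by simp only [Prod.mk.eta]; omega))
  rw [mul_sub, map_sub, sub_eq_zero] at this
  exact this

theorem mul_varProd_sq (hp : IsPseudoexpectation d pE) (s : Multiset (E × A)) :
    ∀ p : MvPolynomial (E × A) ℝ, p.totalDegree + 2 * s.card ≤ 4 * d →
      pE (p * varProd s ^ 2) = pE (p * varProd s) := by
  induction s using Multiset.induction_on with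
  | empty => intro p _; simp [varProd_zero]
  | cons a s ih =>
    intro p h
    rw [Multiset.card_cons] at h
    have hs := totalDegree_varProd_le s
    have h1 : (p * varProd s ^ 2).totalDegree ≤ p.totalDegree + 2 * s.card := by
      have h2 := totalDegree_mul p (varProd s ^ 2)
      have h3 := totalDegree_pow (varProd s) 2
      omega
    have h2 : (p * X a).totalDegree ≤ p.totalDegree + 1 := by
      have h3 := totalDegree_mul p (X a)
      rwa [totalDegree_X] at h3
    rw [varProd_cons, show p * (X a * varProd s) ^ 2 = p * varProd s ^ 2 * X a ^ 2 by ring,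
      hp.mul_X_sq _ _ (by omega), show p * varProd s ^ 2 * X a = p * X a * varProd s ^ 2 by ring,
      ih _ (by omega), mul_assoc]

theorem varProd_sq (hp : IsPseudoexpectation d pE) (s : Multiset (E × A))
    (h : s.card ≤ 2 * d) : pE (varProd s ^ 2) = pE (varProd s) := by
  have := hp.mul_varProd_sq s 1 (by rw [totalDegree_one]; omega)
  rwa [one_mul, one_mul] at this

theorem varProd_nonneg (hp : IsPseudoexpectation d pE) (s : Multiset (E × A))
    (h : s.card ≤ 2 * d) : 0 ≤ pE (varProd s) := by
  rw [← hp.varProd_sq s h]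
  exact hp.sq_nonneg _ ((totalDegree_varProd_le s).trans h)

theorem mul_sum_X (hp : IsPseudoexpectation d pE) (p : MvPolynomial (E × A) ℝ) (e : E)
    (h : p.totalDegree + 1 ≤ 4 * d) : pE (p * ∑ j : A, X (e, j)) = pE p := by
  have hX : ((∑ j : A, X (e, j)) - 1 : MvPolynomial (E × A) ℝ).totalDegree ≤ 1 := by
    refine (totalDegree_sub _ _).trans (max_le ?_ (by rw [totalDegree_one]; omega))
    exact totalDegree_finsetSum_le fun j _ => by rw [totalDegree_X]
  have := hp.sum_one e p ((totalDegree_mul _ _).trans (by omega))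
  rwa [mul_sub, map_sub, sub_eq_zero, mul_one] at this

/-- Assigning two different symbols to one edge has pseudoprobability zero. -/
theorem varProd_eq_zero (hp : IsPseudoexpectation d pE) {s : Multiset (E × A)} {e : E} {j k : A}
    (hjk : j ≠ k) (h : s.card + 2 ≤ 2 * d) :
    pE (varProd ((e, j) ::ₘ (e, k) ::ₘ s)) = 0 := by
  classical
  have hs := totalDegree_varProd_le s
  have hm : (varProd s * X (e, j)).totalDegree ≤ s.card + 1 := by
    have h3 := totalDegree_mul (varProd s) (X (e, j))
    rw [totalDegree_X] at h3
    omega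
  have hsum := hp.mul_sum_X (varProd s * X (e, j)) e (by omega)
  rw [Finset.mul_sum, map_sum, ← Finset.add_sum_erase _ _ (Finset.mem_univ j),
    show varProd s * X (e, j) * X (e, j) = varProd s * X (e, j) ^ 2 by ring,
    hp.mul_X_sq _ _ (by omega), add_eq_left] at hsum
  have hterm : ∀ i, varProd s * X (e, j) * X (e, i) = varProd ((e, j) ::ₘ (e, i) ::ₘ s) := by
    intro i
    rw [varProd_cons, varProd_cons]
    ring
  rw [Finset.sum_eq_zero_iff_of_nonneg] at hsum
  · rw [← hterm]
    exact hsum k (Finset.mem_erase.2 ⟨hjk.symm, Finset.mem_univ k⟩)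
  · intro i _
    rw [hterm]
    exact hp.varProd_nonneg _ (by simpa only [Multiset.card_cons] using h)

theorem varProd_add_eq_zero (hp : IsPseudoexpectation d pE) {s t : Multiset (E × A)} {e : E}
    {j k : A} (hj : (e, j) ∈ s) (hk : (e, k) ∈ t) (hjk : j ≠ k) (h : s.card + t.card ≤ 2 * d) :
    pE (varProd s * varProd t) = 0 := by
  obtain ⟨s, rfl⟩ := Multiset.exists_cons_of_mem hj
  obtain ⟨t, rfl⟩ := Multiset.exists_cons_of_mem hk
  rw [← varProd_add, Multiset.cons_add, Multiset.add_cons]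
  refine hp.varProd_eq_zero hjk ?_
  simp only [Multiset.card_cons, Multiset.card_add] at h ⊢
  omega

theorem mul_one_sub_varProd_nonneg (hp : IsPseudoexpectation d pE) {s t : Multiset (E × A)}
    (hs : s.card ≤ d) (ht : t.card ≤ d) : 0 ≤ pE (varProd s * (1 - varProd t)) := by
  have ds := totalDegree_varProd_le s
  have dt := totalDegree_varProd_le t
  have ds2 := totalDegree_pow (varProd s) 2
  have h1 : pE (varProd s ^ 2 * varProd t ^ 2) = pE (varProd s ^ 2 * varProd t) :=
    hp.mul_varProd_sq t _ (by omega)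
  have h2 : pE (varProd s ^ 2 * varProd t) = pE (varProd s * varProd t) := by
    rw [mul_comm, hp.mul_varProd_sq s _ (by omega), mul_comm]
  have h3 := hp.varProd_sq s (by omega)
  have h4 := hp.sq_nonneg (varProd s - varProd s * varProd t) <| by
    have h5 := totalDegree_sub (varProd s) (varProd s * varProd t)
    have h6 := totalDegree_mul (varProd s) (varProd t)
    refine h5.trans (max_le ?_ ?_) <;> omega
  rw [show (varProd s - varProd s * varProd t) ^ 2 = varProd s ^ 2 - varProd s ^ 2 * varProd t
      - varProd s ^ 2 * varProd t + varProd s ^ 2 * varProd t ^ 2 by ring,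
    map_add, map_sub, map_sub, h1, h2, h3] at h4
  rw [mul_sub, mul_one, map_sub]
  linarith

theorem prod_sum_X (hp : IsPseudoexpectation d pE) {ι : Type*} (e : ι → E) (s : Finset ι)
    (hs : s.card ≤ 4 * d) : pE (∏ i ∈ s, ∑ j : A, X (e i, j)) = 1 := by
  classical
  induction s using Finset.induction_on with
  | empty => simpa using hp.one
  | insert a s ha ih =>
    rw [Finset.card_insert_of_notMem ha] at hs
    rw [Finset.prod_insert ha, mul_comm, hp.mul_sum_X, ih (by omega)]
    refine le_trans (Nat.add_le_add_right ((totalDegree_finsetProd _ _).trans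
      (Finset.sum_le_card_nsmul s _ 1 fun i _ => ?_)) 1) (by simpa using hs)
    exact totalDegree_finsetSum_le fun j _ => by rw [totalDegree_X]

theorem sum_prod_X (hp : IsPseudoexpectation d pE) (e : Fin d → E) :
    ∑ α : Fin d → A, pE (∏ i, X (e i, α i)) = 1 := by
  classical
  rw [← map_sum, ← hp.prod_sum_X e Finset.univ (by simp; omega), Finset.prod_univ_sum,
    Fintype.piFinset_univ]

end IsPseudoexpectation

/-- The expander mixing bound extends from real-valued functions to vector-valued ones, given
here through their Gram matrix. -/
theorem BipartiteGraph.EML.gram_le {L R E : Type*} {d : ℕ} [Fintype L] [Fintype R] [Fintype E]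
    {G : BipartiteGraph L R E d} {lam : ℝ} (hG : G.EML lam) (hlam : 0 ≤ lam)
    {Q : Matrix (L ⊕ R) (L ⊕ R) ℝ} (hQ : Q.PosSemidef) :
    (∑ e, Q (.inl (G.eL e)) (.inr (G.eR e))) / (Fintype.card E : ℝ) -
        (∑ ℓ, ∑ r, Q (.inl ℓ) (.inr r)) / ((Fintype.card L : ℝ) * Fintype.card R) ≤
      lam * ((∑ ℓ, Q (.inl ℓ) (.inl ℓ)) / (Fintype.card L : ℝ) +
        (∑ r, Q (.inr r) (.inr r)) / (Fintype.card R : ℝ)) / 2 := by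
  obtain ⟨m, K, hK⟩ := Matrix.posSemidef_iff_eq_sum_vecMulVec.1 hQ
  have hQK : ∀ a b, Q a b = ∑ c, K c a * K c b := fun a b => by
    simp [hK, Matrix.sum_apply, Matrix.vecMulVec_apply]
  have key : ∀ c, (∑ e, K c (.inl (G.eL e)) * K c (.inr (G.eR e))) / (Fintype.card E : ℝ) -
      (∑ ℓ, ∑ r, K c (.inl ℓ) * K c (.inr r)) / ((Fintype.card L : ℝ) * Fintype.card R) ≤
      lam * ((∑ ℓ, K c (.inl ℓ) ^ 2) / (Fintype.card L : ℝ) +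
        (∑ r, K c (.inr r) ^ 2) / (Fintype.card R : ℝ)) / 2 := by
    intro c
    have h := (le_abs_self _).trans (hG (fun ℓ => K c (.inl ℓ)) (fun r => K c (.inr r)))
    rw [div_mul_div_comm, Finset.sum_mul_sum] at h
    refine h.trans ?_
    set a := (∑ ℓ, K c (.inl ℓ) ^ 2) / (Fintype.card L : ℝ)
    set b := (∑ r, K c (.inr r) ^ 2) / (Fintype.card R : ℝ)
    have ha : 0 ≤ a := by positivity
    have hb : 0 ≤ b := by positivity
    have h2 := two_mul_le_add_sq (√a) (√b)
    rw [Real.sq_sqrt ha, Real.sq_sqrt hb] at h2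
    nlinarith [mul_le_mul_of_nonneg_left h2 hlam]
  have hsum := Finset.sum_le_sum fun c (_ : c ∈ Finset.univ) => key c
  simp only [hQK, ← sq]
  rw [Finset.sum_sub_distrib, ← Finset.sum_div, ← Finset.sum_div, ← Finset.sum_div,
    ← Finset.mul_sum, Finset.sum_add_distrib, ← Finset.sum_div, ← Finset.sum_div] at hsum
  have hLR : ∑ ℓ, ∑ r, ∑ c, K c (.inl ℓ) * K c (.inr r) =
      ∑ c, ∑ ℓ, ∑ r, K c (.inl ℓ) * K c (.inr r) :=
    (Finset.sum_congr rfl fun ℓ _ => Finset.sum_comm).trans Finset.sum_comm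
  rw [hLR, Finset.sum_comm, Finset.sum_comm (f := fun ℓ c => K c (.inl ℓ) ^ 2),
    Finset.sum_comm (f := fun r c => K c (.inr r) ^ 2)]
  exact hsum

theorem BipartiteGraph.sum_edges {L R E : Type*} {d : ℕ} [Fintype L] [Fintype E]
    (G : BipartiteGraph L R E d) (φ : E → ℝ) : ∑ e, φ e = ∑ ℓ, ∑ i, φ (G.oL ℓ i).1 := by
  rw [← Fintype.sum_sigma' (fun ℓ i => φ (G.oL ℓ i).1)]
  exact (Fintype.sum_equiv ((Equiv.sigmaCongrRight G.oL).trans (Equiv.sigmaFiberEquiv G.eL))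
    _ _ fun _ => rfl).symm

/-- Gram matrices of low-degree polynomials under a pseudoexpectation are positive
semidefinite. -/
theorem IsPseudoexpectation.posSemidef_gram {E A ι : Type*} [Fintype A] [Fintype ι] {d : ℕ}
    {pE : MvPolynomial (E × A) ℝ →ₗ[ℝ] ℝ} (hp : IsPseudoexpectation d pE)
    (w : ι → MvPolynomial (E × A) ℝ) (hw : ∀ i, (w i).totalDegree ≤ 2 * d) :
    (Matrix.of fun i j => pE (w i * w j)).PosSemidef := by
  refine Matrix.PosSemidef.of_dotProduct_mulVec_nonneg ?_ fun x => ?_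
  · ext i j
    simp [mul_comm]
  · have h := hp.sq_nonneg (∑ i, x i • w i) <|
      MvPolynomial.totalDegree_finsetSum_le fun i _ =>
        (MvPolynomial.totalDegree_smul_le _ _).trans (hw i)
    refine h.trans_eq ?_
    rw [sq, Finset.sum_mul_sum, map_sum]
    simp only [dotProduct, Matrix.mulVec, Matrix.of_apply, map_sum, smul_mul_smul_comm, map_smul,
      smul_eq_mul, Finset.mul_sum, star_trivial]
    exact Finset.sum_congr rfl fun i _ => Finset.sum_congr rfl fun j _ => by ring

/-- (SoS distance proof for AEL.) If `Ẽ` is an `η`-good degree-`4d`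
pseudocodeword and `h ∈ Σ^E` has all left blocks in `C_X` with `Δ_{L,⊥}(Ẽ,h) > 0`, then
`Δ_R(Ẽ,h) ≥ δ_in − (λ + η)/Δ_{L,⊥}(Ẽ,h)`. -/
theorem stmt16 (F : Type*) [Field F] [Fintype F]
    (L R E : Type*) [Fintype L] [Fintype R] [Fintype E]
    (n d b : ℕ) (hn : 0 < n) (hd : 0 < d)
    (hL : Fintype.card L = n) (hR : Fintype.card R = n)
    (G : BipartiteGraph L R E d)
    (δin : ℝ) (hδ0 : 0 ≤ δin) (hδ1 : δin ≤ 1)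
    (CX CZ : Submodule F (Fin d → Fin b → F)) (hCZX : orth CZ ≤ CX)
    (hdist : ∀ c ∈ CX, c ∉ orth CZ →
      δin * d ≤ (({i : Fin d | c i ≠ 0} : Set (Fin d)).ncard : ℝ))
    (lam : ℝ) (hEML : G.EML lam)
    (η : ℝ)
    (pE : MvPolynomial (E × (Fin b → F)) ℝ →ₗ[ℝ] ℝ)
    -- `Ẽ(1) = 1`
    (hone : pE 1 = 1)
    -- `Ẽ(p²) ≥ 0` for every `p` of total degree at most `2d`
    (hsq : ∀ p : MvPolynomial (E × (Fin b → F)) ℝ, p.totalDegree ≤ 2 * d → 0 ≤ pE (p ^ 2))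
    -- Boolean-ness constraints `Z_{e,j}² = Z_{e,j}`
    (hbool : ∀ (e : E) (j : Fin b → F) (p : MvPolynomial (E × (Fin b → F)) ℝ),
      (p * (MvPolynomial.X (e, j) ^ 2 - MvPolynomial.X (e, j))).totalDegree ≤ 4 * d →
      pE (p * (MvPolynomial.X (e, j) ^ 2 - MvPolynomial.X (e, j))) = 0)
    -- each edge gets exactly one symbol: `Σ_j Z_{e,j} = 1`
    (hsum1 : ∀ (e : E) (p : MvPolynomial (E × (Fin b → F)) ℝ),
      (p * ((∑ j : Fin b → F, MvPolynomial.X (e, j)) - 1)).totalDegree ≤ 4 * d →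
      pE (p * ((∑ j : Fin b → F, MvPolynomial.X (e, j)) - 1)) = 0)
    -- left blocks are constrained to lie in `C_X`
    (hcode : ∀ (ℓ : L) (α : Fin d → (Fin b → F)), α ∉ CX →
      ∀ p : MvPolynomial (E × (Fin b → F)) ℝ,
      (p * indL G ℓ α).totalDegree ≤ 4 * d → pE (p * indL G ℓ α) = 0)
    -- `Ẽ` is `η`-good
    (hgood : (∑ ℓ : L, ∑ r : R, ∑ α : Fin d → (Fin b → F), ∑ β : Fin d → (Fin b → F),
        |pE (indL G ℓ α * indR G r β) - pE (indL G ℓ α) * pE (indR G r β)|)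
          / ((n : ℝ) * n) ≤ η)
    (h : E → (Fin b → F)) (hhC : ∀ ℓ : L, G.blockL h ℓ ∈ CX)
    (ΔLperp : ℝ)
    -- `Δ_{L,⊥}(Ẽ,h) = E_ℓ [ Σ_{α : α − h_ℓ ∉ C_Z^⊥} Ẽ(1_{ℓ,α}) ]`
    (hΔL : ΔLperp = (∑ ℓ : L, ∑ α : Fin d → (Fin b → F),
        Set.indicator {α : Fin d → (Fin b → F) | α - G.blockL h ℓ ∉ orth CZ}
          (fun α => pE (indL G ℓ α)) α) / n)
    (hΔLpos : 0 < ΔLperp) :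
    (∑ r : R, (1 - pE (indR G r (G.blockR h r)))) / n ≥ δin - (lam + η) / ΔLperp := by
  classical
  have hp : IsPseudoexpectation d pE := ⟨hone, hsq, hbool, hsum1⟩
  have hn' : (0 : ℝ) < n := by exact_mod_cast hn
  have hd' : (0 : ℝ) < d := by exact_mod_cast hd
  have hlam : 0 ≤ lam := by
    have h1 := (abs_nonneg _).trans (hEML (fun _ => 1) (fun _ => 1))
    simpa [hL, hR, hn'.ne'] using h1
  have hE : (Fintype.card E : ℝ) = n * d := by
    have h1 := G.sum_edges fun _ => 1
    simpa [hL] using h1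
  let SL : L → (Fin d → Fin b → F) → Multiset (E × (Fin b → F)) :=
    fun ℓ α => Finset.univ.val.map fun i => ((G.oL ℓ i).1, α i)
  let SR : R → Multiset (E × (Fin b → F)) :=
    fun r => Finset.univ.val.map fun i => ((G.oR r i).1, h (G.oR r i).1)
  have hSL : ∀ ℓ α, (SL ℓ α).card = d := fun ℓ α => by simp [SL]
  have hSR : ∀ r, (SR r).card = d := fun r => by simp [SR]
  have hX : ∀ ℓ α, indL G ℓ α = varProd (SL ℓ α) := fun ℓ α => prod_X_eq_varProd _
  have hY : ∀ r, indR G r (G.blockR h r) = varProd (SR r) := fun r => prod_X_eq_varProd _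
  have hXdeg : ∀ ℓ α, (indL G ℓ α).totalDegree ≤ d := fun ℓ α => by
    rw [hX]; exact (totalDegree_varProd_le _).trans (hSL ℓ α).le
  have hYdeg : ∀ r, (indR G r (G.blockR h r)).totalDegree ≤ d := fun r => by
    rw [hY]; exact (totalDegree_varProd_le _).trans (hSR r).le
  have hX0 : ∀ ℓ α, 0 ≤ pE (indL G ℓ α) := fun ℓ α => by
    rw [hX]; exact hp.varProd_nonneg _ (by rw [hSL]; omega)
  have hXX : ∀ ℓ α β, α ≠ β → pE (indL G ℓ α * indL G ℓ β) = 0 := by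
    intro ℓ α β hαβ
    obtain ⟨i, hi⟩ := Function.ne_iff.1 hαβ
    rw [hX, hX]
    refine hp.varProd_add_eq_zero (e := (G.oL ℓ i).1) (j := α i) (k := β i)
      (Multiset.mem_map_of_mem _ (Finset.mem_univ_val i))
      (Multiset.mem_map_of_mem _ (Finset.mem_univ_val i)) hi ?_
    rw [hSL, hSL]; omega
  have hXsq : ∀ ℓ α, pE (indL G ℓ α * indL G ℓ α) = pE (indL G ℓ α) := by
    intro ℓ α
    rw [hX, ← sq]
    exact hp.varProd_sq _ (by rw [hSL]; omega)
  let B : L → Finset (Fin d → Fin b → F) := fun ℓ => {α | α - G.blockL h ℓ ∉ orth CZ}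
  let u : L → MvPolynomial (E × (Fin b → F)) ℝ := fun ℓ => ∑ α ∈ B ℓ, indL G ℓ α
  let v : R → MvPolynomial (E × (Fin b → F)) ℝ := fun r => 1 - indR G r (G.blockR h r)
  have hu : ∀ ℓ, (u ℓ).totalDegree ≤ d := fun ℓ =>
    MvPolynomial.totalDegree_finsetSum_le fun α _ => hXdeg ℓ α
  have hv : ∀ r, (v r).totalDegree ≤ d := fun r =>
    (MvPolynomial.totalDegree_sub _ _).trans
      (max_le (by rw [MvPolynomial.totalDegree_one]; omega) (hYdeg r))
  have hpu : ∀ ℓ, pE (u ℓ) = ∑ α ∈ B ℓ, pE (indL G ℓ α) := fun ℓ => map_sum _ _ _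
  have hpv : ∀ r, pE (v r) = 1 - pE (indR G r (G.blockR h r)) := fun r => by
    rw [map_sub, hone]
  have huu : ∀ ℓ, pE (u ℓ * u ℓ) ≤ 1 := by
    intro ℓ
    have h1 : pE (u ℓ * u ℓ) = pE (u ℓ) := by
      rw [Finset.sum_mul_sum, map_sum, hpu]
      refine Finset.sum_congr rfl fun α hα => ?_
      rw [map_sum, Finset.sum_eq_single_of_mem α hα fun β _ hβ => hXX ℓ α β hβ.symm, hXsq]
    rw [h1, hpu, ← hp.sum_prod_X fun i => (G.oL ℓ i).1]
    exact Finset.sum_le_sum_of_subset_of_nonneg (Finset.subset_univ _) fun α _ _ => hX0 ℓ α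
  have hvv : ∀ r, pE (v r * v r) ≤ 1 := by
    intro r
    have h1 := hp.varProd_sq (SR r) (by rw [hSR]; omega)
    have h2 := hp.varProd_nonneg (SR r) (by rw [hSR]; omega)
    have h3 : v r * v r = 1 - varProd (SR r) - varProd (SR r) + varProd (SR r) ^ 2 := by
      simp only [v, hY]; ring
    rw [h3, map_add, map_sub, map_sub, h1, hone]
    linarith
  have hΔ : ΔLperp = (∑ ℓ, pE (u ℓ)) / n := by
    rw [hΔL]
    congr 1
    refine Finset.sum_congr rfl fun ℓ _ => ?_
    rw [hpu]
    simp only [B, Finset.sum_filter, Set.indicator_apply, Set.mem_ofPred_eq]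
  -- every misdecoded left vertex sees many edges on which it disagrees with `h`
  have hlocal : ∀ ℓ, δin * d * pE (u ℓ) ≤ ∑ i, pE (u ℓ * v (G.eR (G.oL ℓ i).1)) := by
    intro ℓ
    have h1 : ∑ i, pE (u ℓ * v (G.eR (G.oL ℓ i).1)) =
        ∑ α ∈ B ℓ, ∑ i, pE (indL G ℓ α * v (G.eR (G.oL ℓ i).1)) := by
      rw [Finset.sum_comm]
      refine Finset.sum_congr rfl fun i _ => ?_
      rw [Finset.sum_mul, map_sum]
    rw [h1, hpu, Finset.mul_sum]
    refine Finset.sum_le_sum fun α hα => ?_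
    have hnonneg : ∀ r, 0 ≤ pE (indL G ℓ α * v r) := fun r => by
      simp only [v, hX, hY]
      exact hp.mul_one_sub_varProd_nonneg (hSL ℓ α).le (hSR r).le
    by_cases hαC : α ∈ CX
    · have hdist' := hdist _ (CX.sub_mem hαC (hhC ℓ)) (Finset.mem_filter.1 hα).2
      rw [Set.ncard_eq_toFinset_card', Set.toFinset_ofPred] at hdist'
      calc δin * d * pE (indL G ℓ α)
          ≤ _ := mul_le_mul_of_nonneg_right hdist' (hX0 ℓ α)
        _ = ∑ i with (α - G.blockL h ℓ) i ≠ 0, pE (indL G ℓ α * v (G.eR (G.oL ℓ i).1)) := by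
          rw [← nsmul_eq_mul, ← Finset.sum_const]
          refine Finset.sum_congr rfl fun i hi => ?_
          have hi' : α i ≠ h (G.oL ℓ i).1 := sub_ne_zero.1 (Finset.mem_filter.1 hi).2
          have hzero : pE (varProd (SL ℓ α) * varProd (SR (G.eR (G.oL ℓ i).1))) = 0 := by
            refine hp.varProd_add_eq_zero (e := (G.oL ℓ i).1) (j := α i)
              (k := h (G.oL ℓ i).1) (Multiset.mem_map_of_mem _ (Finset.mem_univ_val i)) ?_ hi' ?_
            · refine Multiset.mem_map.2
                ⟨(G.oR _).symm ⟨(G.oL ℓ i).1, rfl⟩, Finset.mem_univ_val _, ?_⟩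
              rw [Equiv.apply_symm_apply]
            · rw [hSL, hSR]; omega
          simp only [v, hX, hY, mul_sub, mul_one, map_sub, hzero, sub_zero]
        _ ≤ _ := Finset.sum_le_sum_of_subset_of_nonneg (Finset.filter_subset _ _)
          fun i _ _ => hnonneg _
    · have h0 := hcode ℓ α hαC 1 (by rw [one_mul]; exact (hXdeg ℓ α).trans (by omega))
      rw [one_mul] at h0
      rw [h0, mul_zero]
      exact Finset.sum_nonneg fun i _ => hnonneg _
  have hedge : δin * ΔLperp ≤
      (∑ e, pE (u (G.eL e) * v (G.eR e))) / (Fintype.card E : ℝ) := by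
    rw [G.sum_edges, hE, hΔ, le_div_iff₀ (by positivity)]
    have h1 := Finset.sum_le_sum fun ℓ (_ : ℓ ∈ Finset.univ) => hlocal ℓ
    rw [← Finset.mul_sum] at h1
    calc _ = δin * d * ∑ ℓ, pE (u ℓ) := by field_simp
      _ ≤ _ := h1
      _ = _ := by
        refine Finset.sum_congr rfl fun ℓ _ => Finset.sum_congr rfl fun i _ => ?_
        rw [(G.oL ℓ i).2]
  set ΔR := (∑ r : R, (1 - pE (indR G r (G.blockR h r)))) / n with hΔR
  have hpair : (∑ ℓ, ∑ r, pE (u ℓ * v r)) / ((n : ℝ) * n) ≤ ΔLperp * ΔR + η := by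
    have h1 : ∀ ℓ r, pE (u ℓ * v r) ≤ pE (u ℓ) * pE (v r) +
        ∑ α : Fin d → (Fin b → F), ∑ β : Fin d → (Fin b → F),
        |pE (indL G ℓ α * indR G r β) - pE (indL G ℓ α) * pE (indR G r β)| := by
      intro ℓ r
      have h2 : pE (u ℓ * v r) - pE (u ℓ) * pE (v r) =
          ∑ α ∈ B ℓ, -(pE (indL G ℓ α * indR G r (G.blockR h r)) -
            pE (indL G ℓ α) * pE (indR G r (G.blockR h r))) := by
        rw [hpu, hpv, Finset.sum_mul, Finset.sum_mul, map_sum, ← Finset.sum_sub_distrib]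
        refine Finset.sum_congr rfl fun α _ => ?_
        simp only [v, mul_sub, mul_one, map_sub]
        ring
      rw [← sub_le_iff_le_add', h2]
      calc _ ≤ ∑ α ∈ B ℓ, ∑ β : Fin d → (Fin b → F),
            |pE (indL G ℓ α * indR G r β) - pE (indL G ℓ α) * pE (indR G r β)| :=
          Finset.sum_le_sum fun α _ => (neg_le_abs _).trans
            (Finset.single_le_sum (f := fun β => |pE (indL G ℓ α * indR G r β) -
              pE (indL G ℓ α) * pE (indR G r β)|) (fun β _ => abs_nonneg _)
              (Finset.mem_univ (G.blockR h r)))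
        _ ≤ _ := Finset.sum_le_sum_of_subset_of_nonneg (Finset.subset_univ _)
          fun α _ _ => Finset.sum_nonneg fun β _ => abs_nonneg _
    have h2 := Finset.sum_le_sum fun ℓ (_ : ℓ ∈ Finset.univ) =>
      Finset.sum_le_sum fun r (_ : r ∈ Finset.univ) => h1 ℓ r
    simp only [Finset.sum_add_distrib] at h2
    rw [← Finset.sum_mul_sum] at h2
    have h3 := div_le_div_of_nonneg_right h2 (mul_pos hn' hn').le
    rw [add_div, ← div_mul_div_comm, ← hΔ] at h3
    simp only [hpv] at h3
    exact h3.trans (add_le_add_right hgood _)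
  have hgram := hEML.gram_le hlam (hp.posSemidef_gram (Sum.elim u v) (by
    rintro (ℓ | r)
    · exact (hu ℓ).trans (by omega)
    · exact (hv r).trans (by omega)))
  simp only [Matrix.of_apply, Sum.elim_inl, Sum.elim_inr, hL, hR] at hgram
  have hUL : (∑ ℓ, pE (u ℓ * u ℓ)) / (n : ℝ) ≤ 1 := by
    rw [div_le_one hn', ← hL]
    simpa using Finset.sum_le_card_nsmul Finset.univ _ 1 fun ℓ _ => huu ℓ
  have hVR : (∑ r, pE (v r * v r)) / (n : ℝ) ≤ 1 := by
    rw [div_le_one hn', ← hR]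
    simpa using Finset.sum_le_card_nsmul Finset.univ _ 1 fun r _ => hvv r
  have hbound := mul_le_mul_of_nonneg_left (add_le_add hUL hVR) hlam
  have hfinal : (δin - ΔR) * ΔLperp ≤ lam + η := by linarith
  rw [ge_iff_le, sub_le_comm, le_div_iff₀ hΔLpos]
  exact hfinal
end
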